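/- arXiv:2211.01590 — 6 statements merged into one kernel-verified Lean document; each statement's English description precedes it below -/
import Mathlib

section
/- Let ϖ be a modulus of continuity and let f : [A,B] → ℝ be C² with f′ > 0 on [A,B] and |f″(x) − f″(y)| ≤ ϖ(|x − y|) for all x,y ∈ [A,B]. Then there is a constant C > 0, depending only on f, ϖ, A, B, such that for all pairwise distinct x₁, x₂, x₃ ∈ [A,B] and every x* with min{x₁,x₂,x₃} ≤ x* ≤ max{x₁,x₂,x₃}, one has |D(x₁,x₂,x₃;f) − 1 − (x₁ − x₃)·f″(x*)/(2 f′(x*))| ≤ C |x₁ − x₃| ϖ(Δ), where Δ = max{x₁,x₂,x₃} − min{x₁,x₂,x₃}. -/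
/-- A modulus of continuity: a continuous, strictly increasing function on `(0,∞)`
with positive values, subadditive, and tending to `0` at `0⁺`. -/
structure IsModulus (w : ℝ → ℝ) : Prop where
  pos : ∀ x : ℝ, 0 < x → 0 < w x
  strictMono : StrictMonoOn w (Set.Ioi 0)
  continuous : ContinuousOn w (Set.Ioi 0)
  subadd : ∀ x y : ℝ, 0 < x → 0 < y → w (x + y) ≤ w x + w y
  tendsto : Filter.Tendsto w (nhdsWithin 0 (Set.Ioi 0)) (nhds 0)

theorem IsModulus.apply_natCast_mul_le {w : ℝ → ℝ} (hw : IsModulus w) (n : ℕ) {x : ℝ}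
    (hx : 0 < x) : w ((n + 1 : ℝ) * x) ≤ (n + 1 : ℝ) * w x := by
  induction n with
  | zero => simp
  | succ k ih =>
    have h := hw.subadd ((k + 1 : ℝ) * x) x (by positivity) hx
    have e : ((k + 1 : ℕ) + 1 : ℝ) * x = (k + 1 : ℝ) * x + x := by push_cast; ring
    rw [e]
    push_cast
    linarith

/-- On a bounded interval a modulus of continuity dominates a multiple of the identity. -/
theorem IsModulus.mul_le {w : ℝ → ℝ} (hw : IsModulus w) {x L : ℝ} (hx : 0 < x) (hxL : x ≤ L) :
    x * w L ≤ 2 * L * w x := by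
  have hwx := hw.pos x hx
  have hL : 0 < L := hx.trans_le hxL
  have hlt := Nat.lt_floor_add_one (L / x)
  have hle : (⌊L / x⌋₊ : ℝ) ≤ L / x := Nat.floor_le (by positivity)
  have hlt' : L < (⌊L / x⌋₊ + 1 : ℝ) * x := (div_lt_iff₀ hx).1 hlt
  have hle' : (⌊L / x⌋₊ : ℝ) * x ≤ L := (le_div_iff₀ hx).1 hle
  have h := hw.apply_natCast_mul_le ⌊L / x⌋₊ hx
  have hm := hw.strictMono hL (hL.trans hlt') hlt'
  calc x * w L ≤ x * ((⌊L / x⌋₊ + 1 : ℝ) * w x) := by gcongr; linarith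
    _ = ((⌊L / x⌋₊ : ℝ) * x + x) * w x := by ring
    _ ≤ 2 * L * w x := by gcongr; linarith

/-- The mean value theorem for second order divided differences, for ordered nodes. -/
theorem exists_divided_difference_eq_of_lt {A B : ℝ} {f f' f'' : ℝ → ℝ}
    (hf' : ∀ x ∈ Set.Icc A B, HasDerivWithinAt f (f' x) (Set.Icc A B) x)
    (hf'' : ∀ x ∈ Set.Icc A B, HasDerivWithinAt f' (f'' x) (Set.Icc A B) x)
    {a b c : ℝ} (ha : A ≤ a) (hab : a < b) (hbc : b < c) (hc : c ≤ B) :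
    ∃ ξ ∈ Set.Icc a c,
      2 * (f a * (b - c) + f b * (c - a) + f c * (a - b)) =
        f'' ξ * ((a - b) * (a - c) * (b - c)) := by
  have hab' : a - b ≠ 0 := sub_ne_zero.2 hab.ne
  have hbc' : b - c ≠ 0 := sub_ne_zero.2 hbc.ne
  have hac' : a - c ≠ 0 := sub_ne_zero.2 (hab.trans hbc).ne
  obtain ⟨K, hK⟩ : ∃ K, f a * (b - c) + f b * (c - a) + f c * (a - b) =
      K * ((a - b) * (a - c) * (b - c)) :=
    ⟨_, (div_mul_cancel₀ _ (mul_ne_zero (mul_ne_zero hab' hac') hbc')).symm⟩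
  obtain ⟨L, hL⟩ : ∃ L, f a - f b = L * (a - b) := ⟨_, (div_mul_cancel₀ _ hab').symm⟩
  set h : ℝ → ℝ := fun t => f t - (L * t + K * ((t - a) * (t - b))) with hh
  set h' : ℝ → ℝ := fun t => f' t - (L + K * ((t - b) + (t - a))) with hh'
  have hd : ∀ x ∈ Set.Icc A B, HasDerivWithinAt h (h' x) (Set.Icc A B) x := by
    intro x hx
    have h1 : HasDerivWithinAt (fun t : ℝ => t) 1 (Set.Icc A B) x := hasDerivWithinAt_id x _
    refine ((hf' x hx).sub ((h1.const_mul L).add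
      (((h1.sub_const a).mul (h1.sub_const b)).const_mul K))).congr_deriv ?_
    simp only [hh']
    ring
  have hd' : ∀ x ∈ Set.Icc A B, HasDerivWithinAt h' (f'' x - 2 * K) (Set.Icc A B) x := by
    intro x hx
    have h1 : HasDerivWithinAt (fun t : ℝ => t) 1 (Set.Icc A B) x := hasDerivWithinAt_id x _
    refine ((hf'' x hx).sub
      ((((h1.sub_const b).add (h1.sub_const a)).const_mul K).const_add L)).congr_deriv ?_
    ring
  have rolle : ∀ {g g' : ℝ → ℝ},
      (∀ x ∈ Set.Icc A B, HasDerivWithinAt g (g' x) (Set.Icc A B) x) →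
      ∀ {u v : ℝ}, A ≤ u → u < v → v ≤ B → g u = g v → ∃ t ∈ Set.Ioo u v, g' t = 0 := by
    intro g g' hg u v hu huv hv he
    refine exists_hasDerivAt_eq_zero huv (fun x hx => ?_) he (fun x hx => ?_)
    · exact (hg x ⟨hu.trans hx.1, hx.2.trans hv⟩).continuousWithinAt.mono
        (Set.Icc_subset_Icc hu hv)
    · exact (hg x ⟨hu.trans hx.1.le, hx.2.le.trans hv⟩).hasDerivAt
        (Icc_mem_nhds (hu.trans_lt hx.1) (hx.2.trans_le hv))
  have eab : h a = h b := by
    simp only [hh]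
    linear_combination hL
  have ebc : h b = h c := by
    simp only [hh]
    apply mul_left_cancel₀ hab'
    linear_combination (b - c) * hL - hK
  obtain ⟨u, hu, hu0⟩ := rolle hd ha hab (hbc.le.trans hc) eab
  obtain ⟨v, hv, hv0⟩ := rolle hd (ha.trans hab.le) hbc hc ebc
  obtain ⟨ξ, hξ, hξ0⟩ := rolle hd' (ha.trans hu.1.le) (hu.2.trans hv.1) (hv.2.le.trans hc)
    (hu0.trans hv0.symm)
  refine ⟨ξ, ⟨(hu.1.trans hξ.1).le, (hξ.2.trans hv.2).le⟩, ?_⟩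
  linear_combination 2 * hK - ((a - b) * (a - c) * (b - c)) * hξ0

/-- The mean value theorem for second order divided differences. -/
theorem exists_divided_difference_eq {A B : ℝ} {f f' f'' : ℝ → ℝ}
    (hf' : ∀ x ∈ Set.Icc A B, HasDerivWithinAt f (f' x) (Set.Icc A B) x)
    (hf'' : ∀ x ∈ Set.Icc A B, HasDerivWithinAt f' (f'' x) (Set.Icc A B) x)
    {a b c : ℝ} (ha : a ∈ Set.Icc A B) (hb : b ∈ Set.Icc A B) (hc : c ∈ Set.Icc A B)
    (hab : a ≠ b) (hbc : b ≠ c) (hac : a ≠ c) :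
    ∃ ξ ∈ Set.Icc (min a (min b c)) (max a (max b c)),
      2 * (f a * (b - c) + f b * (c - a) + f c * (a - b)) =
        f'' ξ * ((a - b) * (a - c) * (b - c)) := by
  have key : ∀ {p q r : ℝ}, A ≤ p → p < q → q < r → r ≤ B → _ :=
    fun h1 h2 h3 h4 => exists_divided_difference_eq_of_lt hf' hf'' h1 h2 h3 h4
  rcases hab.lt_or_gt with h1 | h1 <;> rcases hbc.lt_or_gt with h2 | h2 <;>
    rcases hac.lt_or_gt with h3 | h3
  · obtain ⟨ξ, hξ, e⟩ := key ha.1 h1 h2 hc.2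
    exact ⟨ξ, ⟨by simp [hξ.1], by simp [hξ.2]⟩, by linear_combination e⟩
  · exact absurd (h1.trans h2) h3.not_gt
  · obtain ⟨ξ, hξ, e⟩ := key ha.1 h3 h2 hb.2
    exact ⟨ξ, ⟨by simp [hξ.1], by simp [hξ.2]⟩, by linear_combination -e⟩
  · obtain ⟨ξ, hξ, e⟩ := key hc.1 h3 h1 hb.2
    exact ⟨ξ, ⟨by simp [hξ.1], by simp [hξ.2]⟩, by linear_combination e⟩
  · obtain ⟨ξ, hξ, e⟩ := key hb.1 h1 h3 hc.2
    exact ⟨ξ, ⟨by simp [hξ.1], by simp [hξ.2]⟩, by linear_combination -e⟩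
  · obtain ⟨ξ, hξ, e⟩ := key hb.1 h2 h3 ha.2
    exact ⟨ξ, ⟨by simp [hξ.1], by simp [hξ.2]⟩, by linear_combination e⟩
  · exact absurd (h2.trans h1) h3.not_gt
  · obtain ⟨ξ, hξ, e⟩ := key hc.1 h2 h1 ha.2
    exact ⟨ξ, ⟨by simp [hξ.1], by simp [hξ.2]⟩, by linear_combination -e⟩

/-- The mean value theorem on a subinterval with unordered endpoints. -/
theorem exists_slope_eq {A B : ℝ} {f f' : ℝ → ℝ}
    (hf' : ∀ x ∈ Set.Icc A B, HasDerivWithinAt f (f' x) (Set.Icc A B) x)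
    {b c : ℝ} (hb : b ∈ Set.Icc A B) (hc : c ∈ Set.Icc A B) (hbc : b ≠ c) :
    ∃ η ∈ Set.Icc (min b c) (max b c), (f b - f c) / (b - c) = f' η := by
  wlog h : b < c generalizing b c
  · obtain ⟨η, hη, e⟩ := this hc hb hbc.symm (lt_of_le_of_ne (not_lt.1 h) hbc.symm)
    refine ⟨η, by rwa [min_comm, max_comm], ?_⟩
    rw [← e, ← neg_sub (f c), ← neg_sub c, neg_div_neg_eq]
  obtain ⟨η, hη, e⟩ := exists_hasDerivAt_eq_slope f f' h
    (fun x hx => (hf' x ⟨hb.1.trans hx.1, hx.2.trans hc.2⟩).continuousWithinAt.mono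
      (Set.Icc_subset_Icc hb.1 hc.2))
    (fun x hx => (hf' x ⟨hb.1.trans hx.1.le, hx.2.le.trans hc.2⟩).hasDerivAt
      (Icc_mem_nhds (hb.1.trans_lt hx.1) (hx.2.trans_le hc.2)))
  refine ⟨η, by rw [min_eq_left h.le, max_eq_right h.le]; exact ⟨hη.1.le, hη.2.le⟩, ?_⟩
  rw [e, ← neg_sub (f c), ← neg_sub c, neg_div_neg_eq]

/-- Cross-ratio estimate (Proposition on ratio distortion) for a `C_{2,ϖ}` function
with positive derivative on `[A,B]`. -/
theorem cross_ratio_estimate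
    (w : ℝ → ℝ) (hw : IsModulus w)
    (A B : ℝ) (hAB : A < B)
    (f f' f'' : ℝ → ℝ)
    (hf' : ∀ x ∈ Set.Icc A B, HasDerivWithinAt f (f' x) (Set.Icc A B) x)
    (hf'' : ∀ x ∈ Set.Icc A B, HasDerivWithinAt f' (f'' x) (Set.Icc A B) x)
    (hf''cont : ContinuousOn f'' (Set.Icc A B))
    (hf'pos : ∀ x ∈ Set.Icc A B, 0 < f' x)
    (hmod : ∀ x ∈ Set.Icc A B, ∀ y ∈ Set.Icc A B, x ≠ y → |f'' x - f'' y| ≤ w |x - y|) :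
    ∃ C > 0, ∀ x₁ ∈ Set.Icc A B, ∀ x₂ ∈ Set.Icc A B, ∀ x₃ ∈ Set.Icc A B,
      x₁ ≠ x₂ → x₂ ≠ x₃ → x₁ ≠ x₃ →
      ∀ xs ∈ Set.Icc (min x₁ (min x₂ x₃)) (max x₁ (max x₂ x₃)),
        |((f x₁ - f x₂) / (x₁ - x₂)) / ((f x₂ - f x₃) / (x₂ - x₃)) - 1 -
            (x₁ - x₃) * (f'' xs / (2 * f' xs))| ≤
          C * |x₁ - x₃| * w (max x₁ (max x₂ x₃) - min x₁ (min x₂ x₃)) := by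
  obtain ⟨z, hz, hzmin⟩ := isCompact_Icc.exists_isMinOn (Set.nonempty_Icc.2 hAB.le)
    (fun x hx => (hf'' x hx).continuousWithinAt : ContinuousOn f' (Set.Icc A B))
  obtain ⟨M, hM⟩ := isCompact_Icc.exists_bound_of_continuousOn hf''cont
  simp only [Real.norm_eq_abs] at hM
  have hm : 0 < f' z := hf'pos z hz
  have hmin : ∀ x ∈ Set.Icc A B, f' z ≤ f' x := fun x hx => hzmin hx
  generalize f' z = m at hm hmin
  have hM0 : 0 ≤ M := (abs_nonneg _).trans (hM A ⟨le_rfl, hAB.le⟩)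
  have hL : 0 < B - A := sub_pos.2 hAB
  have hwL : 0 < w (B - A) := hw.pos _ hL
  refine ⟨1 / m + M * M * (2 * (B - A) / w (B - A)) / (m * m), by positivity, ?_⟩
  intro a ha b hb c hc hab hbc hac x hx
  obtain ⟨ξ, hξ, eξ⟩ := exists_divided_difference_eq hf' hf'' ha hb hc hab hbc hac
  obtain ⟨η, hη', eη⟩ := exists_slope_eq hf' hb hc hbc
  have hη : η ∈ Set.Icc (min a (min b c)) (max a (max b c)) :=
    ⟨(min_le_right _ _).trans hη'.1, hη'.2.trans (le_max_right _ _)⟩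
  have hsub : Set.Icc (min a (min b c)) (max a (max b c)) ⊆ Set.Icc A B :=
    Set.Icc_subset_Icc (le_min ha.1 (le_min hb.1 hc.1)) (max_le ha.2 (max_le hb.2 hc.2))
  have hpos : 0 < max a (max b c) - min a (min b c) := by
    rcases hab.lt_or_gt with h | h
    · exact sub_pos.2 (((min_le_left _ _).trans_lt h).trans_le (by simp))
    · exact sub_pos.2 (((min_le_right _ _).trans (min_le_left _ _)).trans_lt
        (h.trans_le (le_max_left _ _)))
  have hle : max a (max b c) - min a (min b c) ≤ B - A :=
    sub_le_sub (max_le ha.2 (max_le hb.2 hc.2)) (le_min ha.1 (le_min hb.1 hc.1))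
  generalize max a (max b c) = q at *
  generalize min a (min b c) = p at *
  have hwΔ := hw.pos _ hpos
  have hΔ : q - p ≤ 2 * (B - A) / w (B - A) * w (q - p) := by
    rw [div_mul_eq_mul_div, le_div_iff₀ hwL]
    exact hw.mul_le hpos hle
  have h2 : |f'' ξ - f'' x| ≤ w (q - p) := by
    rcases eq_or_ne ξ x with rfl | hne
    · simpa using hwΔ.le
    · refine (hmod ξ (hsub hξ) x (hsub hx) hne).trans ?_
      exact hw.strictMono.monotoneOn (abs_pos.2 (sub_ne_zero.2 hne)) hpos
        (abs_sub_le_iff.2 ⟨sub_le_sub hξ.2 hx.1, sub_le_sub hx.2 hξ.1⟩)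
  have h1 : |f' x - f' η| ≤ M * (q - p) := by
    have h := (convex_Icc A B).norm_image_sub_le_of_norm_hasDerivWithin_le hf''
      (fun y hy => hM y hy) (hsub hη) (hsub hx)
    exact h.trans (mul_le_mul_of_nonneg_left
      (abs_sub_le_iff.2 ⟨sub_le_sub hx.2 hη.1, sub_le_sub hη.2 hx.1⟩) hM0)
  have hmη := hmin η (hsub hη)
  have hmx := hmin x (hsub hx)
  have hη0 : 0 < f' η := hm.trans_le hmη
  have hx0 : 0 < f' x := hm.trans_le hmx
  have hab' : a - b ≠ 0 := sub_ne_zero.2 hab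
  have hbc' : b - c ≠ 0 := sub_ne_zero.2 hbc
  have hD : (f a - f b) / (a - b) = f' η + (a - c) * (f'' ξ / 2) := by
    rw [← eη]
    field_simp
    linear_combination eξ
  have hE : (f a - f b) / (a - b) / ((f b - f c) / (b - c)) - 1 - (a - c) * (f'' x / (2 * f' x)) =
      (a - c) * (((f'' ξ - f'' x) / f' η + f'' x * (f' x - f' η) / (f' η * f' x)) / 2) := by
    rw [hD, eη]
    field_simp
    ring
  have b1 : |(f'' ξ - f'' x) / f' η| ≤ w (q - p) / m := by
    rw [abs_div, abs_of_pos hη0]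
    gcongr
  have b2 : |f'' x * (f' x - f' η) / (f' η * f' x)| ≤
      M * (M * (2 * (B - A) / w (B - A) * w (q - p))) / (m * m) := by
    rw [abs_div, abs_mul, abs_of_pos (mul_pos hη0 hx0)]
    gcongr
    · exact hM x (hsub hx)
    · exact h1.trans (by gcongr)
  rw [hE, abs_mul, abs_div, abs_two, mul_comm _ |a - c|, mul_assoc]
  refine mul_le_mul_of_nonneg_left ?_ (abs_nonneg _)
  have h3 := (abs_add_le _ _).trans (add_le_add b1 b2)
  refine (half_le_self (abs_nonneg _)).trans (h3.trans (le_of_eq ?_))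
  ring
end

section
/- Let ϖ be a modulus of continuity and let f : [A,B] → ℝ be C² with f′ > 0 on [A,B] and |f″(x) − f″(y)| ≤ ϖ(|x − y|) for all x,y ∈ [A,B]. Then there is a constant C > 0, depending only on f, ϖ, A, B, such that for all pairwise distinct x₁, x₂, x₃, x₄ ∈ [A,B], one has |Dist(x₁,x₂,x₃,x₄;f) − 1| ≤ C |x₁ − x₃| ϖ(Δ), where Δ = max{x₁,x₂,x₃,x₄} − min{x₁,x₂,x₃,x₄}. -/
/-- The cross-ratio of four pairwise distinct reals. -/
noncomputable def crossRatio (x₁ x₂ x₃ x₄ : ℝ) : ℝ :=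
  ((x₁ - x₂) * (x₃ - x₄)) / ((x₂ - x₃) * (x₄ - x₁))

/-- The cross-ratio distortion of four pairwise distinct points under `f`. -/
noncomputable def crossRatioDistortion (f : ℝ → ℝ) (x₁ x₂ x₃ x₄ : ℝ) : ℝ :=
  crossRatio (f x₁) (f x₂) (f x₃) (f x₄) / crossRatio x₁ x₂ x₃ x₄

theorem IsModulus.map_succ_mul_le {w : ℝ → ℝ} (hw : IsModulus w) {d : ℝ} (hd : 0 < d) (n : ℕ) :
    w ((n + 1) * d) ≤ (n + 1) * w d := by
  induction n with
  | zero => simp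
  | succ n ih =>
    have h := hw.subadd ((n + 1) * d) d (by positivity) hd
    push_cast
    rw [show ((n : ℝ) + 1 + 1) * d = (n + 1) * d + d by ring]
    linarith

/-- On a bounded interval, a modulus of continuity dominates a multiple of the identity. -/
theorem IsModulus.le_mul_map {w : ℝ → ℝ} (hw : IsModulus w) {L d : ℝ} (hd : 0 < d) (hdL : d ≤ L) :
    d ≤ 2 * L / w L * w d := by
  have hL : 0 < L := hd.trans_le hdL
  have hwd := hw.pos d hd
  have h1 : L < (⌊L / d⌋₊ + 1) * d := (div_lt_iff₀ hd).1 (Nat.lt_floor_add_one (L / d))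
  have h2 : (⌊L / d⌋₊ : ℝ) * d ≤ L := (le_div_iff₀ hd).1 (Nat.floor_le (by positivity))
  have h3 : w L < w ((⌊L / d⌋₊ + 1) * d) :=
    hw.strictMono (Set.mem_Ioi.2 hL) (Set.mem_Ioi.2 (hL.trans h1)) h1
  have h4 := hw.map_succ_mul_le hd ⌊L / d⌋₊
  rw [div_mul_eq_mul_div, le_div_iff₀ (hw.pos L hL)]
  calc d * w L ≤ d * ((⌊L / d⌋₊ + 1) * w d) := by gcongr; linarith
    _ = (⌊L / d⌋₊ * d + d) * w d := by ring
    _ ≤ 2 * L * w d := by gcongr; linarith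

section

variable {A B : ℝ} {f f' f'' : ℝ → ℝ}

theorem exists_mem_Ioo_slope_eq
    (hf' : ∀ x ∈ Set.Icc A B, HasDerivWithinAt f (f' x) (Set.Icc A B) x)
    {x y : ℝ} (hx : A ≤ x) (hxy : x < y) (hy : y ≤ B) :
    ∃ c ∈ Set.Ioo x y, f' c = (f y - f x) / (y - x) := by
  have hsub : Set.Icc x y ⊆ Set.Icc A B := Set.Icc_subset_Icc hx hy
  refine exists_hasDerivAt_eq_slope f f' hxy
    (fun z hz => ((hf' z (hsub hz)).mono hsub).continuousWithinAt) fun z hz => ?_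
  exact (hf' z (hsub (Set.Ioo_subset_Icc_self hz))).hasDerivAt
    (Icc_mem_nhds (hx.trans_lt hz.1) (hz.2.trans_le hy))

theorem exists_mem_Icc_slope_eq
    (hf' : ∀ x ∈ Set.Icc A B, HasDerivWithinAt f (f' x) (Set.Icc A B) x)
    {x y : ℝ} (hx : x ∈ Set.Icc A B) (hy : y ∈ Set.Icc A B) (hxy : x ≠ y) :
    ∃ c ∈ Set.Icc A B, f x - f y = f' c * (x - y) := by
  rcases hxy.lt_or_gt with h | h
  · obtain ⟨c, hc, e⟩ := exists_mem_Ioo_slope_eq hf' hx.1 h hy.2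
    refine ⟨c, ⟨hx.1.trans hc.1.le, hc.2.le.trans hy.2⟩, ?_⟩
    rw [eq_div_iff (sub_pos.2 h).ne'] at e
    linarith
  · obtain ⟨c, hc, e⟩ := exists_mem_Ioo_slope_eq hf' hy.1 h hx.2
    refine ⟨c, ⟨hy.1.trans hc.1.le, hc.2.le.trans hx.2⟩, ?_⟩
    rw [eq_div_iff (sub_pos.2 h).ne'] at e
    linarith

/-- Mean value theorem for second divided differences, at ordered points. -/
theorem exists_secondDividedDifference_eq_of_lt
    (hf' : ∀ x ∈ Set.Icc A B, HasDerivWithinAt f (f' x) (Set.Icc A B) x)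
    (hf'' : ∀ x ∈ Set.Icc A B, HasDerivWithinAt f' (f'' x) (Set.Icc A B) x)
    {x y z : ℝ} (hx : A ≤ x) (hxy : x < y) (hyz : y < z) (hz : z ≤ B) :
    ∃ c ∈ Set.Icc x z,
      f x * (y - z) + f y * (z - x) + f z * (x - y) =
        -(f'' c / 2 * ((x - y) * (y - z) * (z - x))) := by
  have hxy' := sub_pos.2 hxy
  have hyz' := sub_pos.2 hyz
  have hxz' := sub_pos.2 (hxy.trans hyz)
  obtain ⟨k, hk⟩ : ∃ k, k = ((f z - f y) / (z - y) - (f y - f x) / (y - x)) / (z - x) :=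
    ⟨_, rfl⟩
  have hp : ∀ t ∈ Set.Icc A B,
      HasDerivWithinAt (fun t => f t - k * t ^ 2) (f' t - k * (2 * t)) (Set.Icc A B) t :=
    fun t ht => (hf' t ht).sub
      (((by simpa using hasDerivAt_pow 2 t : HasDerivAt (fun t : ℝ => t ^ 2) (2 * t) t).const_mul
        k).hasDerivWithinAt)
  obtain ⟨a, ha, ea⟩ := exists_mem_Ioo_slope_eq hp hx hxy (hyz.le.trans hz)
  obtain ⟨b, hb, eb⟩ := exists_mem_Ioo_slope_eq hp (hx.trans hxy.le) hyz hz
  have hab : a < b := ha.2.trans hb.1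
  obtain ⟨c, hc, ec⟩ :=
    exists_mem_Ioo_slope_eq hf'' (hx.trans ha.1.le) hab (hb.2.le.trans hz)
  refine ⟨c, ⟨ha.1.le.trans hc.1.le, hc.2.le.trans hb.2.le⟩, ?_⟩
  have key : f' b - f' a = 2 * k * (b - a) := by
    have h : f' a - k * (2 * a) = f' b - k * (2 * b) := by
      rw [ea, eb, hk]
      field_simp
      ring
    linarith
  have hck : f'' c = 2 * k := by
    rw [ec, key, mul_div_assoc, div_self (sub_pos.2 hab).ne', mul_one]
  rw [hck, hk]
  field_simp
  ring

/-- Mean value theorem for second divided differences, at distinct points. -/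
theorem exists_secondDividedDifference_eq
    (hf' : ∀ x ∈ Set.Icc A B, HasDerivWithinAt f (f' x) (Set.Icc A B) x)
    (hf'' : ∀ x ∈ Set.Icc A B, HasDerivWithinAt f' (f'' x) (Set.Icc A B) x)
    {u v x y z : ℝ} (hu : A ≤ u) (hv : v ≤ B) (hx : x ∈ Set.Icc u v) (hy : y ∈ Set.Icc u v)
    (hz : z ∈ Set.Icc u v) (hxy : x ≠ y) (hyz : y ≠ z) (hxz : x ≠ z) :
    ∃ c ∈ Set.Icc u v,
      f x * (y - z) + f y * (z - x) + f z * (x - y) =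
        -(f'' c / 2 * ((x - y) * (y - z) * (z - x))) := by
  have sorted : ∀ {x y z : ℝ}, x ∈ Set.Icc u v → z ∈ Set.Icc u v → x < y → y < z →
      ∃ c ∈ Set.Icc u v, f x * (y - z) + f y * (z - x) + f z * (x - y) =
        -(f'' c / 2 * ((x - y) * (y - z) * (z - x))) := fun hx hz h₁ h₂ =>
    let ⟨c, hc, e⟩ := exists_secondDividedDifference_eq_of_lt hf' hf'' (hu.trans hx.1) h₁ h₂
      (hz.2.trans hv)
    ⟨c, Set.Icc_subset_Icc hx.1 hz.2 hc, e⟩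
  rcases hxy.lt_or_gt with h₁ | h₁ <;> rcases hyz.lt_or_gt with h₂ | h₂ <;>
    rcases hxz.lt_or_gt with h₃ | h₃
  · exact sorted hx hz h₁ h₂
  · linarith
  · obtain ⟨c, hc, e⟩ := sorted hx hy h₃ h₂
    exact ⟨c, hc, by linarith⟩
  · obtain ⟨c, hc, e⟩ := sorted hz hy h₃ h₁
    exact ⟨c, hc, by linarith⟩
  · obtain ⟨c, hc, e⟩ := sorted hy hz h₁ h₃
    exact ⟨c, hc, by linarith⟩
  · obtain ⟨c, hc, e⟩ := sorted hy hx h₂ h₃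
    exact ⟨c, hc, by linarith⟩
  · linarith
  · obtain ⟨c, hc, e⟩ := sorted hz hx h₂ h₁
    exact ⟨c, hc, by linarith⟩

end

theorem crossRatioDistortion_eq_of_slopes {f : ℝ → ℝ} {x₁ x₂ x₃ x₄ p q r s : ℝ}
    (h₁₂ : x₁ ≠ x₂) (h₂₃ : x₂ ≠ x₃) (h₃₄ : x₃ ≠ x₄) (h₁₄ : x₁ ≠ x₄)
    (hp : f x₁ - f x₂ = p * (x₁ - x₂)) (hq : f x₃ - f x₄ = q * (x₃ - x₄))
    (hr : f x₂ - f x₃ = r * (x₂ - x₃)) (hs : f x₄ - f x₁ = s * (x₄ - x₁))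
    (hr₀ : r ≠ 0) (hs₀ : s ≠ 0) :
    crossRatioDistortion f x₁ x₂ x₃ x₄ = p * q / (r * s) := by
  have h₁ := sub_ne_zero.2 h₁₂
  have h₂ := sub_ne_zero.2 h₂₃
  have h₃ := sub_ne_zero.2 h₃₄
  have h₄ := sub_ne_zero.2 h₁₄.symm
  rw [crossRatioDistortion, crossRatio, crossRatio, hp, hq, hr, hs]
  field_simp

/-- Cross-ratio distortion estimate for a `C_{2,ϖ}` function with positive
derivative on `[A,B]`. -/
theorem cross_ratio_distortion_estimate
    (w : ℝ → ℝ) (hw : IsModulus w)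
    (A B : ℝ) (hAB : A < B)
    (f f' f'' : ℝ → ℝ)
    (hf' : ∀ x ∈ Set.Icc A B, HasDerivWithinAt f (f' x) (Set.Icc A B) x)
    (hf'' : ∀ x ∈ Set.Icc A B, HasDerivWithinAt f' (f'' x) (Set.Icc A B) x)
    (hf''cont : ContinuousOn f'' (Set.Icc A B))
    (hf'pos : ∀ x ∈ Set.Icc A B, 0 < f' x)
    (hmod : ∀ x ∈ Set.Icc A B, ∀ y ∈ Set.Icc A B, x ≠ y → |f'' x - f'' y| ≤ w |x - y|) :
    ∃ C > 0, ∀ x₁ ∈ Set.Icc A B, ∀ x₂ ∈ Set.Icc A B, ∀ x₃ ∈ Set.Icc A B, ∀ x₄ ∈ Set.Icc A B,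
      x₁ ≠ x₂ → x₁ ≠ x₃ → x₁ ≠ x₄ → x₂ ≠ x₃ → x₂ ≠ x₄ → x₃ ≠ x₄ →
        |crossRatioDistortion f x₁ x₂ x₃ x₄ - 1| ≤
          C * |x₁ - x₃| *
            w (max (max x₁ x₂) (max x₃ x₄) - min (min x₁ x₂) (min x₃ x₄)) := by
  obtain ⟨ξ, hξ, hmin⟩ := isCompact_Icc.exists_isMinOn (Set.nonempty_Icc.2 hAB.le)
    (fun x hx => (hf'' x hx).continuousWithinAt : ContinuousOn f' (Set.Icc A B))
  obtain ⟨M₁, hM₁⟩ := isCompact_Icc.exists_bound_of_continuousOn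
    (fun x hx => (hf'' x hx).continuousWithinAt : ContinuousOn f' (Set.Icc A B))
  obtain ⟨M₂, hM₂⟩ := isCompact_Icc.exists_bound_of_continuousOn hf''cont
  simp only [Real.norm_eq_abs] at hM₁ hM₂
  set m := f' ξ
  have hm₀ : 0 < m := hf'pos ξ hξ
  have hmf : ∀ x ∈ Set.Icc A B, m ≤ f' x := fun x hx => hmin hx
  have hM₁₀ : 0 < M₁ := (abs_pos.2 hm₀.ne').trans_le (hM₁ ξ hξ)
  have hM₂₀ : 0 ≤ M₂ := (abs_nonneg _).trans (hM₂ ξ hξ)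
  set K := 2 * (B - A) / w (B - A)
  have hK₀ : 0 < K := div_pos (by linarith) (hw.pos _ (sub_pos.2 hAB))
  refine ⟨(M₁ / 2 + M₂ / 2 * (K * (M₂ / 2))) / (m * m), by positivity, ?_⟩
  intro x₁ hx₁ x₂ hx₂ x₃ hx₃ x₄ hx₄ h₁₂ h₁₃ h₁₄ h₂₃ h₂₄ h₃₄
  set v := max (max x₁ x₂) (max x₃ x₄) with hv
  set u := min (min x₁ x₂) (min x₃ x₄) with hu
  have hAu : A ≤ u := by simp [hu, hx₁.1, hx₂.1, hx₃.1, hx₄.1]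
  have hvB : v ≤ B := by simp [hv, hx₁.2, hx₂.2, hx₃.2, hx₄.2]
  have hu₁ : x₁ ∈ Set.Icc u v := by simp [hu, hv]
  have hu₂ : x₂ ∈ Set.Icc u v := by simp [hu, hv]
  have hu₃ : x₃ ∈ Set.Icc u v := by simp [hu, hv]
  have hu₄ : x₄ ∈ Set.Icc u v := by simp [hu, hv]
  have hsub : Set.Icc u v ⊆ Set.Icc A B := Set.Icc_subset_Icc hAu hvB
  have hΔ : 0 < v - u := (abs_pos.2 (sub_ne_zero.2 h₁₂)).trans_le
    (abs_sub_le_iff.2 ⟨by linarith [hu₁.2, hu₂.1], by linarith [hu₂.2, hu₁.1]⟩)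
  have hwΔ := hw.pos _ hΔ
  have hKΔ : v - u ≤ K * w (v - u) := hw.le_mul_map hΔ (by linarith)
  obtain ⟨p, hp, ep⟩ := exists_mem_Icc_slope_eq hf' hx₁ hx₂ h₁₂
  obtain ⟨q, hq, eq⟩ := exists_mem_Icc_slope_eq hf' hx₃ hx₄ h₃₄
  obtain ⟨r, hr, er⟩ := exists_mem_Icc_slope_eq hf' hx₂ hx₃ h₂₃
  obtain ⟨s, hs, es⟩ := exists_mem_Icc_slope_eq hf' hx₄ hx₁ h₁₄.symm
  have hr₀ := hf'pos r hr
  have hs₀ := hf'pos s hs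
  obtain ⟨a, ha, ea⟩ := exists_secondDividedDifference_eq hf' hf'' hAu hvB hu₁ hu₃ hu₂
    h₁₃ h₂₃.symm h₁₂
  obtain ⟨b, hb, eb⟩ := exists_secondDividedDifference_eq hf' hf'' hAu hvB hu₁ hu₃ hu₄
    h₁₃ h₃₄ h₁₄
  obtain ⟨c, hc, ec⟩ := exists_secondDividedDifference_eq hf' hf'' hAu hvB hu₃ hu₂ hu₄
    h₂₃.symm h₂₄ h₃₄
  have hpr : f' p - f' r = (x₁ - x₃) * (f'' a / 2) := by
    refine mul_right_cancel₀ (mul_ne_zero (sub_ne_zero.2 h₁₂) (sub_ne_zero.2 h₂₃)) ?_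
    linear_combination (-(x₂ - x₃)) * ep + (x₁ - x₂) * er - ea
  have hsq : f' s - f' q = (x₁ - x₃) * (f'' b / 2) := by
    refine mul_right_cancel₀ (mul_ne_zero (sub_ne_zero.2 h₁₄) (sub_ne_zero.2 h₃₄)) ?_
    linear_combination (x₃ - x₄) * es + (x₁ - x₄) * eq + eb
  have hqr : f' q - f' r = (x₄ - x₂) * (f'' c / 2) := by
    refine mul_right_cancel₀ (mul_ne_zero (sub_ne_zero.2 h₃₄) (sub_ne_zero.2 h₂₃)) ?_
    linear_combination (-(x₂ - x₃)) * eq + (x₃ - x₄) * er + ec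
  have hab : |f'' a - f'' b| ≤ w (v - u) := by
    by_cases h : a = b
    · simpa [h] using hwΔ.le
    · refine (hmod a (hsub ha) b (hsub hb) h).trans ?_
      have hd : |a - b| ≤ v - u := abs_sub_le_iff.2
        ⟨by linarith [ha.2, hb.1], by linarith [hb.2, ha.1]⟩
      exact hw.strictMono.monotoneOn (abs_pos.2 (sub_ne_zero.2 h)) hΔ hd
  have h42 : |x₄ - x₂| ≤ K * w (v - u) := (abs_sub_le_iff.2
    ⟨by linarith [hu₄.2, hu₂.1], by linarith [hu₂.2, hu₄.1]⟩).trans hKΔ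
  have hnum : |(f'' a - f'' b) / 2 * f' q + f'' b / 2 * ((x₄ - x₂) * (f'' c / 2))| ≤
      (M₁ / 2 + M₂ / 2 * (K * (M₂ / 2))) * w (v - u) := by
    refine (abs_add_le _ _).trans ?_
    simp only [abs_mul, abs_div, Nat.abs_ofNat]
    calc _ ≤ w (v - u) / 2 * M₁ + M₂ / 2 * (K * w (v - u) * (M₂ / 2)) := by
          gcongr
          exacts [hM₁ q hq, hM₂ b (hsub hb), hM₂ c (hsub hc)]
      _ = _ := by ring
  rw [crossRatioDistortion_eq_of_slopes h₁₂ h₂₃ h₃₄ h₁₄ ep eq er es hr₀.ne' hs₀.ne']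
  have key : f' p * f' q / (f' r * f' s) - 1 =
      (x₁ - x₃) * ((f'' a - f'' b) / 2 * f' q + f'' b / 2 * ((x₄ - x₂) * (f'' c / 2))) /
        (f' r * f' s) := by
    rw [div_sub_one (by positivity)]
    congr 1
    linear_combination f' q * hpr - f' r * hsq + (x₁ - x₃) * (f'' b / 2) * hqr
  rw [key, abs_div, abs_mul, abs_of_pos (mul_pos hr₀ hs₀)]
  calc _ ≤ |x₁ - x₃| * ((M₁ / 2 + M₂ / 2 * (K * (M₂ / 2))) * w (v - u)) / (m * m) := by
        gcongr
        exacts [hmf r hr, hmf s hs]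
    _ = _ := by ring
end

section
/- For every ξ ∈ 𝕋¹, every n ∈ ℕ, and every integer i with 0 < i < q_{n+1}, the fundamental segments Δ⁽ⁿ⁾(ξ) and Δ⁽ⁿ⁾(Tⁱξ) intersect at most in their endpoints. In particular, for any fixed ξ₀, the segments Δᵢ⁽ⁿ⁾ for 0 ≤ i < q_{n+1} have pairwise disjoint interiors. -/
namespace CircleDeg1Lift

/-- If the translation number is irrational, a strict inequality between two translated iterates
at one point is inherited by the corresponding translations. -/
theorem mul_translationNumber_lt_of_iterate_lt (f : CircleDeg1Lift)
    (hf : Irrational (translationNumber f)) {u v : ℕ} {a : ℤ} {x : ℝ}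
    (h : f^[u] x < f^[v] x + a) :
    u * translationNumber f < v * translationNumber f + a := by
  obtain rfl | huv := eq_or_ne u v
  · linarith
  refine lt_of_le_of_ne ?_ fun heq ↦ ?_
  · rcases le_total u v with huv' | huv'
    · obtain ⟨d, rfl⟩ := Nat.exists_eq_add_of_le' huv'
      rw [Function.iterate_add_apply] at h
      have hle : f^[u] x + (-a : ℤ) ≤ (f ^ d) (f^[u] x) := by
        rw [coe_pow]; push_cast; linarith
      have := le_translationNumber_of_add_int_le _ hle
      rw [translationNumber_pow] at this
      push_cast at this ⊢
      linarith
    · obtain ⟨d, rfl⟩ := Nat.exists_eq_add_of_le' huv'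
      rw [Function.iterate_add_apply] at h
      have hle : (f ^ d) (f^[v] x) ≤ f^[v] x + a := by
        rw [coe_pow]; exact h.le
      have := translationNumber_le_of_le_add_int _ hle
      rw [translationNumber_pow] at this
      push_cast at this ⊢
      linarith
  · have hne : (u : ℤ) - v ≠ 0 := sub_ne_zero.2 (by exact_mod_cast huv)
    refine (hf.intCast_mul hne).ne_int a ?_
    push_cast
    linarith

end CircleDeg1Lift

section Convergents

variable {k p q : ℕ → ℕ}

theorem convergents_denom_pos (hk : ∀ n, 1 ≤ k (n + 1)) (hq0 : q 0 = 1) (hq1 : q 1 = k 1)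
    (hqrec : ∀ n, q (n + 2) = k (n + 2) * q (n + 1) + q n) (n : ℕ) : 0 < q n := by
  induction n using Nat.twoStepInduction with
  | zero => omega
  | one => have := hk 0; simp only [zero_add] at this; omega
  | more n ih _ => rw [hqrec]; omega

theorem convergents_determinant (hp0 : p 0 = 0) (hp1 : p 1 = 1) (hq0 : q 0 = 1)
    (hprec : ∀ n, p (n + 2) = k (n + 2) * p (n + 1) + p n)
    (hqrec : ∀ n, q (n + 2) = k (n + 2) * q (n + 1) + q n) (n : ℕ) :
    (p (n + 1) * q n - p n * q (n + 1) : ℤ) = (-1) ^ n := by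
  induction n with
  | zero => simp [hp0, hp1, hq0]
  | succ n ih =>
    rw [hprec, hqrec, pow_succ, ← ih]
    push_cast
    ring

theorem convergents_error_sign {ρ : ℝ} (hirr : Irrational ρ) (hq : ∀ n, 0 < q n)
    (hdet : ∀ n, (p (n + 1) * q n - p n * q (n + 1) : ℤ) = (-1) ^ n)
    (hprec : ∀ n, p (n + 2) = k (n + 2) * p (n + 1) + p n)
    (hqrec : ∀ n, q (n + 2) = k (n + 2) * q (n + 1) + q n)
    (hconv : Filter.Tendsto (fun n => (p n : ℝ) / (q n : ℝ)) Filter.atTop (nhds ρ)) (n : ℕ) :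
    0 < (-1) ^ n * (q n * ρ - p n) := by
  have hq' (m : ℕ) : (0 : ℝ) < q m := by exact_mod_cast hq m
  have hmono : Monotone fun m : ℕ ↦ (-1 : ℝ) ^ n * (p (n + 2 * m) / q (n + 2 * m)) := by
    refine monotone_nat_of_le_succ fun m ↦ ?_
    have hd : ((p (n + 2 * m + 1) * q (n + 2 * m) - p (n + 2 * m) * q (n + 2 * m + 1) : ℤ) : ℝ)
        = (-1) ^ n := by
      rw [hdet]; simp [pow_add, pow_mul]
    push_cast at hd
    have hsq : (-1 : ℝ) ^ n * (-1) ^ n = 1 := by rw [← mul_pow]; simp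
    have h1 := hq' (n + 2 * m)
    have h2 := hq' (n + 2 * m + 2)
    have key : (-1 : ℝ) ^ n * (p (n + 2 * m + 2) / q (n + 2 * m + 2))
        - (-1 : ℝ) ^ n * (p (n + 2 * m) / q (n + 2 * m))
        = k (n + 2 * m + 2) / (q (n + 2 * m + 2) * q (n + 2 * m)) := by
      have hnum : (p (n + 2 * m + 2) * q (n + 2 * m) - q (n + 2 * m + 2) * p (n + 2 * m) : ℝ)
          = k (n + 2 * m + 2) * (-1) ^ n := by
        rw [hprec, hqrec, ← hd]; push_cast; ring
      rw [← mul_sub, div_sub_div _ _ h2.ne' h1.ne', hnum, mul_div_assoc']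
      congr 1
      linear_combination (k (n + 2 * m + 2) : ℝ) * hsq
    have : (0 : ℝ) ≤ k (n + 2 * m + 2) / (q (n + 2 * m + 2) * q (n + 2 * m)) := by positivity
    change _ ≤ (-1 : ℝ) ^ n * (p (n + 2 * m + 2) / q (n + 2 * m + 2))
    linarith
  have hlim : Filter.Tendsto (fun m : ℕ ↦ (-1 : ℝ) ^ n * (p (n + 2 * m) / q (n + 2 * m)))
      Filter.atTop (nhds ((-1) ^ n * ρ)) :=
    (hconv.comp (Filter.tendsto_atTop_mono (fun m ↦ by simp only [id]; omega) Filter.tendsto_id :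
      Filter.Tendsto (fun m ↦ n + 2 * m) Filter.atTop Filter.atTop)).const_mul _
  have hle := hmono.ge_of_tendsto hlim 0
  simp only [mul_zero, add_zero] at hle
  have hge : 0 ≤ (-1) ^ n * (q n * ρ - p n) := by
    have := mul_le_mul_of_nonneg_left hle (hq' n).le
    have e : (q n : ℝ) * ((-1) ^ n * (p n / q n)) = (-1) ^ n * p n := by
      field_simp [(hq' n).ne']
    rw [e] at this
    linarith
  refine lt_of_le_of_ne hge (Ne.symm (mul_ne_zero (by simp) (sub_ne_zero.2 ?_)))
  exact_mod_cast (hirr.natCast_mul (hq n).ne').ne_nat (p n)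

/-- The best approximation property: no denominator below `q₁` approximates `ρ` better than `q₀`,
for consecutive convergents `p₀ / q₀` and `p₁ / q₁` lying on opposite sides of `ρ`. -/
theorem abs_error_le_of_lt_denom {ρ : ℝ} {p₀ q₀ p₁ q₁ i m ε : ℤ} (hq₀ : 0 < q₀)
    (hε : ε * ε = 1) (hdet : p₁ * q₀ - p₀ * q₁ = ε)
    (h₀ : 0 < ε * (q₀ * ρ - p₀)) (h₁ : ε * (q₁ * ρ - p₁) < 0) (hi : 0 < i) (hi' : i < q₁) :
    |q₀ * ρ - p₀| ≤ |i * ρ - m| := by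
  obtain ⟨a, b, hia, hmb⟩ : ∃ a b : ℤ, i = a * q₀ + b * q₁ ∧ m = a * p₀ + b * p₁ :=
    ⟨ε * (i * p₁ - m * q₁), ε * (m * q₀ - i * p₀),
      by linear_combination (-i) * hε - ε * i * hdet, by
        linear_combination (-m) * hε - ε * m * hdet⟩
  have hε' : |(ε : ℝ)| = 1 := by
    rw [← sq_eq_sq₀ (abs_nonneg _) zero_le_one, sq_abs]
    exact_mod_cast (by rw [sq, hε]; norm_num : ε ^ 2 = 1 ^ 2)
  have habs (y : ℝ) : |y| = |ε * y| := by rw [abs_mul, hε', one_mul]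
  rw [habs, habs (i * ρ - m), abs_of_pos h₀]
  have hsplit : ε * (i * ρ - m) = a * (ε * (q₀ * ρ - p₀)) + b * (ε * (q₁ * ρ - p₁)) := by
    rw [hia, hmb]; push_cast; ring
  rw [hsplit]
  rcases le_or_gt b 0 with hb | hb
  · have ha : 1 ≤ a := by
      by_contra! h
      nlinarith
    have ha' : (1 : ℝ) ≤ a := by exact_mod_cast ha
    have hb' : (b : ℝ) ≤ 0 := by exact_mod_cast hb
    exact le_abs.2 (Or.inl (by nlinarith))
  · have ha : a ≤ -1 := by
      by_contra! h
      nlinarith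
    have ha' : (a : ℝ) ≤ -1 := by exact_mod_cast ha
    have hb' : (0 : ℝ) < b := by exact_mod_cast hb
    exact le_abs.2 (Or.inr (by nlinarith))

end Convergents


/-- Disjointness of fundamental segments (Lemma 1 of Khanin–Teplinsky):
for `0 < i < q_{n+1}`, the open fundamental segments `Δ⁽ⁿ⁾(ξ)` and `Δ⁽ⁿ⁾(Tⁱξ)`
on the circle `ℝ/ℤ` are disjoint (they may touch only at endpoints); in particular
all `Δᵢ⁽ⁿ⁾`, `0 ≤ i < q_{n+1}`, have pairwise disjoint interiors. -/
theorem fundamental_segments_disjoint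
    (F : ℝ → ℝ) (hF : StrictMono F) (hFc : Continuous F)
    (hFp : ∀ x, F (x + 1) = F x + 1)
    (ρ : ℝ) (hρ : ρ ∈ Set.Ioo (0:ℝ) 1) (hirr : Irrational ρ)
    (hrot : ∀ x : ℝ,
      Filter.Tendsto (fun n : ℕ => (F^[n] x - x) / (n : ℝ)) Filter.atTop (nhds ρ))
    (k p q : ℕ → ℕ) (hk : ∀ n, 1 ≤ k (n + 1))
    (hp0 : p 0 = 0) (hp1 : p 1 = 1) (hq0 : q 0 = 1) (hq1 : q 1 = k 1)
    (hprec : ∀ n, p (n + 2) = k (n + 2) * p (n + 1) + p n)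
    (hqrec : ∀ n, q (n + 2) = k (n + 2) * q (n + 1) + q n)
    (hconv : Filter.Tendsto (fun n => (p n : ℝ) / (q n : ℝ)) Filter.atTop (nhds ρ))
    -- `seg n x` is the interior (in lift coordinates) of the n-th fundamental
    -- segment `Δ⁽ⁿ⁾` based at the point of the circle with lift `x`
    (seg : ℕ → ℝ → Set ℝ)
    (hseg : ∀ n x, seg n x =
      if Even n then Set.Ioo x (F^[q n] x - (p n : ℝ))
      else Set.Ioo (F^[q n] x - (p n : ℝ)) x) :
    ∀ n : ℕ,
      (∀ ξ : ℝ, ∀ i : ℕ, 0 < i → i < q (n + 1) →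
        Disjoint ((fun t : ℝ => (t : AddCircle (1:ℝ))) '' seg n ξ)
          ((fun t : ℝ => (t : AddCircle (1:ℝ))) '' seg n (F^[i] ξ))) ∧
      (∀ ξ₀ : ℝ, ∀ i j : ℕ, i < j → j < q (n + 1) →
        Disjoint ((fun t : ℝ => (t : AddCircle (1:ℝ))) '' seg n (F^[i] ξ₀))
          ((fun t : ℝ => (t : AddCircle (1:ℝ))) '' seg n (F^[j] ξ₀))) := by
  intro n
  have hq := convergents_denom_pos hk hq0 hq1 hqrec
  have hdet := convergents_determinant hp0 hp1 hq0 hprec hqrec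
  have hsign := convergents_error_sign hirr hq hdet hprec hqrec hconv
  let f : CircleDeg1Lift := ⟨⟨F, hF.monotone⟩, hFp⟩
  have hτ : CircleDeg1Lift.translationNumber f = ρ := by
    refine tendsto_nhds_unique (f.tendsto_translationNumber 0) ?_
    simp only [CircleDeg1Lift.coe_pow]
    exact hrot 0
  have horder {u v : ℕ} {a : ℤ} {x : ℝ} (h : F^[u] x < F^[v] x + a) : u * ρ < v * ρ + a := by
    simpa only [hτ] using f.mul_translationNumber_lt_of_iterate_lt (hτ ▸ hirr) h
  have hdisj (ξ : ℝ) (i : ℕ) (hi : 0 < i) (hi' : i < q (n + 1)) :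
      Disjoint ((fun t : ℝ => (t : AddCircle (1:ℝ))) '' seg n ξ)
        ((fun t : ℝ => (t : AddCircle (1:ℝ))) '' seg n (F^[i] ξ)) := by
    rw [Set.disjoint_left]
    rintro _ ⟨t, ht, rfl⟩ ⟨s, hs, hst⟩
    obtain ⟨m, hm⟩ : ∃ m : ℤ, s = t + m := by
      have h0 : ((s - t : ℝ) : AddCircle (1:ℝ)) = 0 := by
        rw [AddCircle.coe_sub, sub_eq_zero]; exact hst
      obtain ⟨m, hm⟩ := (AddCircle.coe_eq_zero_iff (1:ℝ)).1 h0
      exact ⟨m, by rw [zsmul_one] at hm; linarith⟩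
    have hbest : |((q n : ℤ) : ℝ) * ρ - (p n : ℤ)| ≤ |((i : ℤ) : ℝ) * ρ - m| := by
      refine abs_error_le_of_lt_denom (p₁ := p (n + 1)) (q₁ := q (n + 1)) (ε := (-1) ^ n)
        (by exact_mod_cast hq n) (by rw [← mul_pow]; simp) (hdet n) ?_ ?_
        (by exact_mod_cast hi) (by exact_mod_cast hi')
      · exact_mod_cast hsign n
      · have := hsign (n + 1)
        rw [pow_succ] at this
        push_cast
        linarith
    push_cast at hbest
    rw [hseg] at ht hs
    rw [← Function.iterate_add_apply] at hs
    subst hm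
    refine hbest.not_gt ?_
    split_ifs at ht hs
    · have h1 : F^[0] ξ < F^[q n + i] ξ + (-(p n) - m : ℤ) := by
        push_cast; simp only [Function.iterate_zero, id]; linarith [ht.1, hs.2]
      have h2 : F^[i] ξ < F^[q n] ξ + (-(p n) + m : ℤ) := by
        push_cast; linarith [ht.2, hs.1]
      replace h1 := horder h1
      replace h2 := horder h2
      push_cast at h1 h2
      exact (abs_lt.2 ⟨by linarith, by linarith⟩).trans_le (le_abs_self _)
    · have h1 : F^[q n + i] ξ < F^[0] ξ + (p n + m : ℤ) := by
        push_cast; simp only [Function.iterate_zero, id]; linarith [ht.2, hs.1]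
      have h2 : F^[q n] ξ < F^[i] ξ + (p n - m : ℤ) := by
        push_cast; linarith [ht.1, hs.2]
      replace h1 := horder h1
      replace h2 := horder h2
      push_cast at h1 h2
      exact (abs_lt.2 ⟨by linarith, by linarith⟩).trans_le (neg_le_abs _)
  refine ⟨hdisj, fun ξ₀ i j hij hj ↦ ?_⟩
  have h := hdisj (F^[i] ξ₀) (j - i) (by omega) (by omega)
  rwa [← Function.iterate_add_apply, Nat.sub_add_cancel hij.le] at h
end

section
/- Fix a marked point ξ₀ ∈ 𝕋¹ and let ξᵢ = Tⁱξ₀. If for some integer i > 0 the point ξᵢ belongs to the fundamental segment Δ₀⁽ⁿ⁾, then i can be written in the form i = qₙ + Σ_{s=n+1}^{n+m} k̂_{s+1} q_s for some integer m ≥ 1 and integers k̂_{s+1} with 0 ≤ k̂_{s+1} ≤ k_{s+1} for each s with n+1 ≤ s ≤ n+m. -/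
/-- `p n / q n` are the convergents of the continued fraction `[k 1, k 2, …]`. -/
structure IsConvergents (k p q : ℕ → ℕ) : Prop where
  one_le_k : ∀ n, 1 ≤ k (n + 1)
  p_zero : p 0 = 0
  p_one : p 1 = 1
  q_zero : q 0 = 1
  q_one : q 1 = k 1
  p_rec : ∀ n, p (n + 2) = k (n + 2) * p (n + 1) + p n
  q_rec : ∀ n, q (n + 2) = k (n + 2) * q (n + 1) + q n

/-- The distance from `q n * ρ` to `p n`, with the sign it has when `p n / q n` are the
convergents of `ρ`. -/
def convergentGap (p q : ℕ → ℕ) (ρ : ℝ) (n : ℕ) : ℝ := (-1) ^ n * (q n * ρ - p n)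

/-- `r` is a combination of `q (n + 1), …, q (n + m)` with digits bounded by `k`. -/
def HasDigitExpansion (k q : ℕ → ℕ) (n r : ℕ) : Prop :=
  ∃ m : ℕ, 1 ≤ m ∧ ∃ c : ℕ → ℕ,
    (∀ s : ℕ, n + 1 ≤ s → s ≤ n + m → c (s + 1) ≤ k (s + 1)) ∧
    r = ∑ s ∈ Finset.Icc (n + 1) (n + m), c (s + 1) * q s

namespace HasDigitExpansion

variable {k q : ℕ → ℕ}

theorem zero (n : ℕ) : HasDigitExpansion k q n 0 :=
  ⟨1, le_rfl, fun _ => 0, by simp, by simp⟩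

theorem cons {n r j : ℕ} (h : HasDigitExpansion k q (n + 1) r) (hj : j ≤ k (n + 2)) :
    HasDigitExpansion k q n (j * q (n + 1) + r) := by
  obtain ⟨m, hm, c, hc, rfl⟩ := h
  refine ⟨m + 1, by omega, Function.update c (n + 2) j, ?_, ?_⟩
  · intro s h1 h2
    obtain rfl | h := eq_or_ne s (n + 1)
    · simpa using hj
    · rw [Function.update_of_ne (by omega)]
      exact hc s (by omega) (by omega)
  · rw [← Finset.add_sum_Ioc_eq_sum_Icc (show n + 1 ≤ n + (m + 1) by omega)]
    rw [show n + 1 + 1 = n + 2 from rfl, Function.update_self]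
    congr 1
    refine Finset.sum_congr ?_ fun s hs => ?_
    · ext s
      simp only [Finset.mem_Icc, Finset.mem_Ioc]
      omega
    · rw [Finset.mem_Ioc] at hs
      rw [Function.update_of_ne (by omega)]

end HasDigitExpansion

namespace IsConvergents

variable {k p q : ℕ → ℕ} {ρ : ℝ}

theorem q_pos (h : IsConvergents k p q) (n : ℕ) : 0 < q n := by
  induction n using Nat.twoStepInduction with
  | zero => simp [h.q_zero]
  | one => rw [h.q_one]; exact h.one_le_k 0
  | more n h0 _ => rw [h.q_rec]; omega

theorem le_q (h : IsConvergents k p q) (n : ℕ) : n ≤ q n := by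
  induction n using Nat.twoStepInduction with
  | zero => simp
  | one => exact h.q_pos 1
  | more n _ h1 =>
    have := h.q_pos n
    have := Nat.mul_le_mul_right (q (n + 1)) (h.one_le_k (n + 1))
    rw [h.q_rec]
    linarith

theorem det_eq (h : IsConvergents k p q) (n : ℕ) :
    (q n * p (n + 1) - p n * q (n + 1) : ℤ) = (-1) ^ n := by
  induction n with
  | zero => simp [h.q_zero, h.p_zero, h.p_one]
  | succ n ih =>
    rw [h.p_rec, h.q_rec, pow_succ, ← ih]
    push_cast
    ring

theorem exists_coordinates (h : IsConvergents k p q) (n : ℕ) (i l : ℤ) :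
    ∃ a b : ℤ, i = a * q n + b * q (n + 1) ∧ l = a * p n + b * p (n + 1) := by
  have hD := h.det_eq n
  have hs : ((-1 : ℤ) ^ n) * (-1) ^ n = 1 := by rw [← mul_pow]; simp
  refine ⟨(-1) ^ n * (i * p (n + 1) - l * q (n + 1)), (-1) ^ n * (l * q n - i * p n), ?_, ?_⟩
  · linear_combination (-i) * hs - (-1) ^ n * i * hD
  · linear_combination (-l) * hs - (-1) ^ n * l * hD

theorem convergentGap_rec (h : IsConvergents k p q) (n : ℕ) :
    convergentGap p q ρ n = k (n + 2) * convergentGap p q ρ (n + 1)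
      + convergentGap p q ρ (n + 2) := by
  simp only [convergentGap, h.q_rec, h.p_rec]
  push_cast
  ring

theorem convergentGap_pos (h : IsConvergents k p q) (hirr : Irrational ρ)
    (hconv : Filter.Tendsto (fun n => (p n : ℝ) / (q n : ℝ)) Filter.atTop (nhds ρ)) (n : ℕ) :
    0 < convergentGap p q ρ n := by
  have hq (m : ℕ) : (0 : ℝ) < q m := by exact_mod_cast h.q_pos m
  have hmono : Monotone fun m => (-1 : ℝ) ^ n * (p (n + 2 * m) / q (n + 2 * m)) := by
    refine monotone_nat_of_le_succ fun m => ?_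
    have hD : (q (n + 2 * m) * p (n + 2 * m + 1) - p (n + 2 * m) * q (n + 2 * m + 1) : ℝ)
        = (-1) ^ (n + 2 * m) := by exact_mod_cast h.det_eq (n + 2 * m)
    rw [pow_add, pow_mul, neg_one_sq, one_pow, mul_one] at hD
    have hs : ((-1 : ℝ) ^ n) * (-1) ^ n = 1 := by rw [← mul_pow]; simp
    rw [← sub_nonneg, show n + 2 * (m + 1) = n + 2 * m + 2 by ring]
    have key : (-1 : ℝ) ^ n * (p (n + 2 * m + 2) / q (n + 2 * m + 2))
        - (-1 : ℝ) ^ n * (p (n + 2 * m) / q (n + 2 * m))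
        = k (n + 2 * m + 2) / (q (n + 2 * m + 2) * q (n + 2 * m)) := by
      have h1 := (hq (n + 2 * m)).ne'
      have h2 := (hq (n + 2 * m + 2)).ne'
      field_simp
      rw [h.p_rec, h.q_rec]
      push_cast
      linear_combination (k (n + 2 * m + 2) : ℝ) * hs + (-1 : ℝ) ^ n * k (n + 2 * m + 2) * hD
    rw [key]
    positivity
  have hlim : Filter.Tendsto (fun m => (-1 : ℝ) ^ n * (p (n + 2 * m) / q (n + 2 * m)))
      Filter.atTop (nhds ((-1) ^ n * ρ)) := by
    refine (hconv.comp (Filter.tendsto_atTop_mono (fun m => ?_) Filter.tendsto_id)).const_mul _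
    simp only [id]
    omega
  have hle := hmono.ge_of_tendsto hlim 0
  simp only [mul_zero, add_zero] at hle
  have hnn : 0 ≤ convergentGap p q ρ n := by
    have := mul_nonneg (hq n).le (sub_nonneg.2 hle)
    have e : (q n : ℝ) * ((-1) ^ n * ρ - (-1) ^ n * (p n / q n)) = convergentGap p q ρ n := by
      have := (hq n).ne'
      unfold convergentGap
      field_simp
    rwa [e] at this
  refine hnn.lt_of_ne' (mul_ne_zero (by simp) ?_)
  exact ((hirr.natCast_mul (h.q_pos n).ne').sub_natCast (p n)).ne_zero

theorem exists_nonneg_coordinates (h : IsConvergents k p q)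
    (hgap : ∀ n, 0 < convergentGap p q ρ n) {n i : ℕ} {l : ℤ}
    (hpos : 0 < (-1) ^ n * (i * ρ - l)) (hle : (-1) ^ n * (i * ρ - l) ≤ convergentGap p q ρ n) :
    ∃ a b : ℕ, i = (a + 1) * q n + b * q (n + 1) ∧
      (-1) ^ n * (i * ρ - l)
        = (a + 1) * convergentGap p q ρ n - b * convergentGap p q ρ (n + 1) := by
  obtain ⟨a, b, hi, hl⟩ := h.exists_coordinates n i l
  have hx : (-1) ^ n * (i * ρ - l)
      = a * convergentGap p q ρ n - b * convergentGap p q ρ (n + 1) := by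
    have hi' : (i : ℝ) = a * q n + b * q (n + 1) := by exact_mod_cast hi
    rw [hi', hl, convergentGap, convergentGap]
    push_cast
    ring
  have hd := hgap n
  have hd' := hgap (n + 1)
  rw [hx] at hpos hle
  have ha : 1 ≤ a := by
    by_contra! ha
    have ha' : (a : ℝ) ≤ 0 := by exact_mod_cast (show a ≤ 0 by omega)
    have hb : b < 0 := by
      by_contra! hb
      have hb' : (0 : ℝ) ≤ b := by exact_mod_cast hb
      nlinarith [mul_nonneg hb' hd'.le, mul_nonneg (neg_nonneg.2 ha') hd.le]
    have hq := h.q_pos n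
    have hq' := h.q_pos (n + 1)
    zify at hq hq'
    nlinarith [mul_nonneg (neg_nonneg.2 (show a ≤ 0 by omega)) hq.le, mul_pos (neg_pos.2 hb) hq']
  have hb : 0 ≤ b := by
    by_contra! hb
    have hb' : (b : ℝ) < 0 := by exact_mod_cast hb
    have ha' : (1 : ℝ) ≤ a := by exact_mod_cast ha
    nlinarith [mul_pos (neg_pos.2 hb') hd', mul_nonneg (sub_nonneg.2 ha') hd.le]
  obtain ⟨a, rfl⟩ : ∃ a' : ℕ, a = a' + 1 := ⟨(a - 1).toNat, by omega⟩
  lift b to ℕ using hb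
  exact ⟨a, b, by exact_mod_cast hi, by rw [hx]; push_cast; ring⟩

/-- The arithmetic form of the expansion: return times of the rotation by `ρ` to its `n`-th
fundamental segment. -/
theorem exists_digitExpansion (h : IsConvergents k p q) (hirr : Irrational ρ)
    (hgap : ∀ n, 0 < convergentGap p q ρ n) (n i : ℕ) (l : ℤ)
    (hpos : 0 < (-1) ^ n * (i * ρ - l)) (hle : (-1) ^ n * (i * ρ - l) ≤ convergentGap p q ρ n) :
    ∃ r, i = q n + r ∧ HasDigitExpansion k q n r := by
  obtain ⟨N, hN⟩ : ∃ N, i < n + N := ⟨i + 1, by omega⟩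
  induction N generalizing n i l with
  | zero =>
    obtain ⟨a, b, hi, -⟩ := h.exists_nonneg_coordinates hgap hpos hle
    have := h.le_q n
    nlinarith [Nat.zero_le (a * q n), Nat.zero_le (b * q (n + 1))]
  | succ N ih =>
    obtain ⟨a, b, hi, hx⟩ := h.exists_nonneg_coordinates hgap hpos hle
    have hrec := h.convergentGap_rec (ρ := ρ) n
    have hd := hgap n
    have hd' := hgap (n + 1)
    obtain hsmall | hlarge := le_or_gt ((-1) ^ n * (i * ρ - l)) (convergentGap p q ρ (n + 2))
    · have hs : (-1 : ℝ) ^ (n + 2) = (-1) ^ n := by rw [pow_add]; simp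
      obtain ⟨r, hr, hE⟩ := ih (n + 2) i l (by rwa [hs]) (by rwa [hs]) (by omega)
      refine ⟨k (n + 2) * q (n + 1) + (0 * q (n + 2) + r), ?_, (hE.cons (Nat.zero_le _)).cons le_rfl⟩
      rw [hr, h.q_rec]
      ring
    · set d := convergentGap p q ρ n
      set d' := convergentGap p q ρ (n + 1) with hd'_def
      have hy : 0 ≤ (d - (-1) ^ n * (i * ρ - l)) / d' := div_nonneg (by linarith) hd'.le
      obtain ⟨j, hj⟩ : ∃ j, j = ⌊(d - (-1) ^ n * (i * ρ - l)) / d'⌋₊ := ⟨_, rfl⟩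
      have hj1 : j * d' ≤ d - (-1) ^ n * (i * ρ - l) := by
        rw [← le_div_iff₀ hd', hj]
        exact Nat.floor_le hy
      have hj2 : d - (-1) ^ n * (i * ρ - l) < (j + 1) * d' := by
        rw [← div_lt_iff₀ hd', hj]
        exact Nat.lt_floor_add_one _
      have hjk : j < k (n + 2) := by
        have : (j : ℝ) < k (n + 2) := by
          refine lt_of_mul_lt_mul_right ?_ hd'.le
          linarith
        exact_mod_cast this
      have hjb : j ≤ b := by
        have : (j : ℝ) ≤ b := by
          refine le_of_mul_le_mul_right ?_ hd'
          have : (0 : ℝ) ≤ a * d := by positivity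
          linarith
        exact_mod_cast this
      obtain ⟨b, rfl⟩ := Nat.exists_eq_add_of_le hjb
      obtain ⟨i', hi'⟩ : ∃ i', i' = a * q n + b * q (n + 1) := ⟨_, rfl⟩
      have hii : i = q n + j * q (n + 1) + i' := by rw [hi, hi']; ring
      obtain rfl | hi0 := Nat.eq_zero_or_pos i'
      · exact ⟨j * q (n + 1) + 0, by omega, (HasDigitExpansion.zero _).cons hjk.le⟩
      · have hx' : (-1) ^ (n + 1) * (i' * ρ - (l - p n - j * p (n + 1) : ℤ))
            = d - (-1) ^ n * (i * ρ - l) - j * d' := by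
          rw [hii, hd'_def]
          simp only [d, convergentGap]
          push_cast
          ring
        have hne : (-1) ^ (n + 1) * (i' * ρ - (l - p n - j * p (n + 1) : ℤ)) ≠ 0 :=
          mul_ne_zero (by simp) ((hirr.natCast_mul hi0.ne').sub_intCast _).ne_zero
        have hq := h.q_pos n
        obtain ⟨r, hr, hE⟩ := ih (n + 1) i' (l - p n - j * p (n + 1))
          (lt_of_le_of_ne (by rw [hx']; linarith) hne.symm) (by rw [hx']; linarith) (by omega)
        refine ⟨(j + 1) * q (n + 1) + r, ?_, hE.cons hjk⟩
        rw [hii, hr]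
        ring

end IsConvergents

namespace CircleDeg1Lift

open Filter

variable (f : CircleDeg1Lift)

theorem le_translationNumber_of_add_int_le_map {x : ℝ} {m : ℤ} (h : x + m ≤ f x) :
    (m : ℝ) ≤ translationNumber f := by
  refine ge_of_tendsto (f.tendsto_translationNumber x) ?_
  filter_upwards [eventually_gt_atTop 0] with n hn
  rw [le_div_iff₀ (by exact_mod_cast hn), coe_pow]
  linarith [f.le_iterate_of_add_int_le_map h n]

theorem translationNumber_le_of_map_le_add_int {x : ℝ} {m : ℤ} (h : f x ≤ x + m) :
    translationNumber f ≤ m := by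
  refine le_of_tendsto (f.tendsto_translationNumber x) ?_
  filter_upwards [eventually_gt_atTop 0] with n hn
  rw [div_le_iff₀ (by exact_mod_cast hn), coe_pow]
  linarith [f.iterate_le_of_map_le_add_int h n]

theorem mul_translationNumber_add_le_of_iterate_add_le {x : ℝ} {a b : ℕ} {m : ℤ}
    (h : f^[a] x + m ≤ f^[b] x) :
    a * translationNumber f + m ≤ b * translationNumber f := by
  obtain hab | hba := le_total a b
  · obtain ⟨c, rfl⟩ := Nat.exists_eq_add_of_le' hab
    rw [Function.iterate_add_apply, ← coe_pow f c] at h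
    have := (f ^ c).le_translationNumber_of_add_int_le_map h
    rw [translationNumber_pow] at this
    push_cast
    linarith
  · obtain ⟨c, rfl⟩ := Nat.exists_eq_add_of_le' hba
    rw [Function.iterate_add_apply, ← coe_pow f c] at h
    have := (f ^ c).translationNumber_le_of_map_le_add_int (x := f^[b] x) (m := -m)
      (by push_cast; linarith)
    rw [translationNumber_pow] at this
    push_cast at this ⊢
    linarith

end CircleDeg1Lift


/-- Lemma 2 of Khanin–Teplinsky: if `ξᵢ ∈ Δ₀⁽ⁿ⁾` for some `i > 0`, then
`i = qₙ + Σ_{s=n+1}^{n+m} k̂_{s+1} q_s` with `m ≥ 1` and `0 ≤ k̂_{s+1} ≤ k_{s+1}`. -/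
theorem index_expansion_of_mem_fundamental_segment
    (F : ℝ → ℝ) (hF : StrictMono F) (hFc : Continuous F)
    (hFp : ∀ x, F (x + 1) = F x + 1)
    (ρ : ℝ) (hρ : ρ ∈ Set.Ioo (0:ℝ) 1) (hirr : Irrational ρ)
    (hrot : ∀ x : ℝ,
      Filter.Tendsto (fun n : ℕ => (F^[n] x - x) / (n : ℝ)) Filter.atTop (nhds ρ))
    (k p q : ℕ → ℕ) (hk : ∀ n, 1 ≤ k (n + 1))
    (hp0 : p 0 = 0) (hp1 : p 1 = 1) (hq0 : q 0 = 1) (hq1 : q 1 = k 1)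
    (hprec : ∀ n, p (n + 2) = k (n + 2) * p (n + 1) + p n)
    (hqrec : ∀ n, q (n + 2) = k (n + 2) * q (n + 1) + q n)
    (hconv : Filter.Tendsto (fun n => (p n : ℝ) / (q n : ℝ)) Filter.atTop (nhds ρ))
    -- `segC n x` is the n-th (closed) fundamental segment `Δ⁽ⁿ⁾` based at the
    -- point of the circle with lift `x`, described in lift coordinates
    (segC : ℕ → ℝ → Set ℝ)
    (hsegC : ∀ n x, segC n x =
      if Even n then Set.Icc x (F^[q n] x - (p n : ℝ))
      else Set.Icc (F^[q n] x - (p n : ℝ)) x) :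
    ∀ ξ₀ : ℝ, ∀ n : ℕ, ∀ i : ℕ, 0 < i →
      ((F^[i] ξ₀ : ℝ) : AddCircle (1:ℝ)) ∈
        (fun t : ℝ => (t : AddCircle (1:ℝ))) '' segC n ξ₀ →
      ∃ m : ℕ, 1 ≤ m ∧ ∃ khat : ℕ → ℕ,
        (∀ s : ℕ, n + 1 ≤ s → s ≤ n + m → khat (s + 1) ≤ k (s + 1)) ∧
        i = q n + ∑ s ∈ Finset.Icc (n + 1) (n + m), khat (s + 1) * q s := by
  intro ξ₀ n i hi hmem
  have h : IsConvergents k p q := ⟨hk, hp0, hp1, hq0, hq1, hprec, hqrec⟩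
  let f : CircleDeg1Lift := ⟨⟨F, hF.monotone⟩, hFp⟩
  have hτ : CircleDeg1Lift.translationNumber f = ρ := by
    refine tendsto_nhds_unique (f.tendsto_translationNumber ξ₀) ?_
    simp only [CircleDeg1Lift.coe_pow]
    exact hrot ξ₀
  have hord (a b : ℕ) (m : ℤ) (hab : F^[a] ξ₀ + m ≤ F^[b] ξ₀) : a * ρ + m ≤ b * ρ :=
    hτ ▸ f.mul_translationNumber_add_le_of_iterate_add_le hab
  obtain ⟨t, ht, hti⟩ := hmem
  obtain ⟨l, hl⟩ : ∃ l : ℤ, F^[i] ξ₀ = t + l := by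
    obtain ⟨l, hl⟩ := (AddCircle.coe_eq_zero_iff (1 : ℝ) (x := F^[i] ξ₀ - t)).1
      (by rw [AddCircle.coe_sub, ← hti, sub_self])
    exact ⟨l, by rw [zsmul_one] at hl; linarith⟩
  have hseg : 0 ≤ (-1) ^ n * (i * ρ - l) ∧ (-1) ^ n * (i * ρ - l) ≤ convergentGap p q ρ n := by
    rw [hsegC] at ht
    unfold convergentGap
    split_ifs at ht with hn
    · have h1 := hord 0 i l (by simpa using by linarith [ht.1])
      have h2 := hord i (q n) (p n - l) (by push_cast; linarith [ht.2])
      push_cast at h1 h2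
      rw [hn.neg_one_pow]
      constructor <;> linarith
    · have h1 := hord i 0 (-l) (by push_cast; simpa using by linarith [ht.2])
      have h2 := hord (q n) i (l - p n) (by push_cast; linarith [ht.1])
      push_cast at h1 h2
      rw [(Nat.not_even_iff_odd.1 hn).neg_one_pow]
      constructor <;> linarith
  have hne : (-1) ^ n * (i * ρ - l) ≠ 0 :=
    mul_ne_zero (by simp) ((hirr.natCast_mul hi.ne').sub_intCast _).ne_zero
  obtain ⟨r, rfl, m, hm, c, hc, rfl⟩ := h.exists_digitExpansion hirr
    (h.convergentGap_pos hirr hconv) n i l (hseg.1.lt_of_ne' hne) hseg.2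
  exact ⟨m, hm, c, hc, rfl⟩
end

section
/- Let λ ∈ (0,1) and let ϖ : (0,1] → (0,∞) be a function such that y ↦ ϖ(y)/y² is antitone on (0,1]. Then for every n ∈ ℕ, Σ_{k=0}^{n} λᵏ ϖ(λ^{n−k}) ≤ (1−λ)⁻¹ λⁿ ∫_{λ^{n+1}}^{1} ϖ(y)/y² dy. -/
theorem AntitoneOn.sub_mul_right_le_integral {g : ℝ → ℝ} {a b : ℝ} (hab : a ≤ b)
    (hg : AntitoneOn g (Set.Icc a b)) : (b - a) * g b ≤ ∫ y in a..b, g y := by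
  have hint : IntervalIntegrable g MeasureTheory.volume a b :=
    AntitoneOn.intervalIntegrable (by rwa [Set.uIcc_of_le hab])
  have h := intervalIntegral.integral_mono_on hab
    (intervalIntegrable_const (c := g b)) hint
    fun y hy => hg hy (Set.right_mem_Icc.2 hab) hy.2
  simpa using h

/-- Summation-to-integral comparison: if `y ↦ ϖ(y)/y²` is antitone on `(0,1]`, then
`Σ_{k=0}^{n} λᵏ ϖ(λ^{n−k}) ≤ (1−λ)⁻¹ λⁿ ∫_{λ^{n+1}}^{1} ϖ(y)/y² dy`. -/
theorem sum_le_integral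
    (lam : ℝ) (hlam0 : 0 < lam) (hlam1 : lam < 1)
    (w : ℝ → ℝ) (hwpos : ∀ y : ℝ, 0 < y → y ≤ 1 → 0 < w y)
    (hanti : ∀ x y : ℝ, 0 < x → x ≤ y → y ≤ 1 → w y / y ^ 2 ≤ w x / x ^ 2) :
    ∀ n : ℕ,
      ∑ j ∈ Finset.range (n + 1), lam ^ j * w (lam ^ (n - j)) ≤
        (1 - lam)⁻¹ * lam ^ n * ∫ y in (lam ^ (n + 1))..1, w y / y ^ 2 := by
  have hsub : 0 < 1 - lam := sub_pos.2 hlam1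
  have hpow (m : ℕ) : 0 < lam ^ m := pow_pos hlam0 m
  have hpow1 (m : ℕ) : lam ^ m ≤ 1 := pow_le_one₀ hlam0.le hlam1.le
  have hantiOn {a b : ℝ} (ha : 0 < a) (hb : b ≤ 1) :
      AntitoneOn (fun y => w y / y ^ 2) (Set.Icc a b) := fun x hx y hy hxy =>
    hanti x y (ha.trans_le hx.1) hxy (hy.2.trans hb)
  have hint {a b : ℝ} (ha : 0 < a) (hab : a ≤ b) (hb : b ≤ 1) :
      IntervalIntegrable (fun y => w y / y ^ 2) MeasureTheory.volume a b :=
    AntitoneOn.intervalIntegrable (by rw [Set.uIcc_of_le hab]; exact hantiOn ha hb)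
  have hle (m : ℕ) : lam ^ (m + 1) ≤ lam ^ m :=
    pow_le_pow_of_le_one hlam0.le hlam1.le m.le_succ
  have hterm (m : ℕ) : w (lam ^ m) ≤
      (1 - lam)⁻¹ * lam ^ m * ∫ y in (lam ^ (m + 1))..(lam ^ m), w y / y ^ 2 := by
    have h := (hantiOn (hpow (m + 1)) (hpow1 m)).sub_mul_right_le_integral (hle m)
    have hc : 0 ≤ (1 - lam)⁻¹ * lam ^ m := (mul_pos (inv_pos.2 hsub) (hpow m)).le
    refine le_of_eq_of_le ?_ (mul_le_mul_of_nonneg_left h hc)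
    have hne := (hpow m).ne'
    have hne' := hsub.ne'
    rw [pow_succ]
    field_simp
  intro n
  induction n with
  | zero => simpa using hterm 0
  | succ n ih =>
    rw [Finset.sum_range_succ', ← intervalIntegral.integral_add_adjacent_intervals
      (hint (hpow (n + 1 + 1)) (hle (n + 1)) (hpow1 (n + 1)))
      (hint (hpow (n + 1)) (hpow1 (n + 1)) le_rfl)]
    have hsum : ∑ j ∈ Finset.range (n + 1), lam ^ (j + 1) * w (lam ^ (n + 1 - (j + 1))) =
        lam * ∑ j ∈ Finset.range (n + 1), lam ^ j * w (lam ^ (n - j)) := by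
      rw [Finset.mul_sum]
      refine Finset.sum_congr rfl fun j _ => ?_
      rw [Nat.add_sub_add_right]
      ring
    rw [hsum, pow_zero, one_mul, Nat.sub_zero]
    calc _ ≤ _ := add_le_add (mul_le_mul_of_nonneg_left ih hlam0.le) (hterm (n + 1))
      _ = _ := by ring
end

section
/- Let ϖ be a modulus of continuity. Then lim_{z→0⁺} z ∫_{z}^{1} ϖ(y)/y² dy = 0. In particular, for every λ ∈ (0,1), λⁿ ∫_{λⁿ}^{1} ϖ(y)/y² dy → 0 as n → ∞. -/
open Set Filter Topology in
/-- Near `0` the modulus is small and on `[δ, 1]` it is bounded, so it is dominated by an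
arbitrarily small constant plus a multiple of `y ^ 2`. -/
lemma IsModulus.exists_le_add_mul_sq {w : ℝ → ℝ} (hw : IsModulus w) {ε : ℝ} (hε : 0 < ε) :
    ∃ K : ℝ, 0 < K ∧ ∀ y : ℝ, 0 < y → y ≤ 1 → w y ≤ ε + K * y ^ 2 := by
  have h1 : 0 < w 1 := hw.pos 1 one_pos
  obtain ⟨δ, hδ, hsmall⟩ := mem_nhdsGT_iff_exists_Ioo_subset.1
    (hw.tendsto.eventually (gt_mem_nhds hε))
  have hδ0 : 0 < δ := hδ
  refine ⟨w 1 / δ ^ 2, by positivity, fun y hy hy1 => ?_⟩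
  rcases lt_or_ge y δ with hyδ | hyδ
  · have : w y < ε := hsmall ⟨hy, hyδ⟩
    have : 0 ≤ w 1 / δ ^ 2 * y ^ 2 := by positivity
    linarith
  · have hle : w y ≤ w 1 := hw.strictMono.monotoneOn hy (mem_Ioi.2 one_pos) hy1
    have : w 1 ≤ w 1 / δ ^ 2 * y ^ 2 := by
      rw [div_mul_eq_mul_div, le_div_iff₀ (by positivity)]
      gcongr
    linarith

lemma IsModulus.intervalIntegrable {w : ℝ → ℝ} (hw : IsModulus w) {z : ℝ} (hz : 0 < z)
    (hz1 : z ≤ 1) : IntervalIntegrable (fun y => w y / y ^ 2) MeasureTheory.volume z 1 := by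
  apply ContinuousOn.intervalIntegrable_of_Icc hz1
  refine (hw.continuous.mono fun y hy => hz.trans_le hy.1).div (by fun_prop) fun y hy => ?_
  have : 0 < y := hz.trans_le hy.1
  positivity

lemma mul_integral_le_of_le_add_mul_sq {w : ℝ → ℝ} (hw : IsModulus w) {ε K : ℝ} (hε : 0 ≤ ε)
    (hK : 0 ≤ K) (h : ∀ y : ℝ, 0 < y → y ≤ 1 → w y ≤ ε + K * y ^ 2) {z : ℝ} (hz : 0 < z)
    (hz1 : z ≤ 1) : z * ∫ y in z..1, w y / y ^ 2 ≤ ε + K * z := by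
  have hpos : ∀ y ∈ Set.Icc z 1, 0 < y := fun y hy => hz.trans_le hy.1
  have hint : IntervalIntegrable (fun y : ℝ => ε / y ^ 2 + K) MeasureTheory.volume z 1 := by
    apply ContinuousOn.intervalIntegrable_of_Icc hz1
    refine (continuousOn_const.div (by fun_prop) fun y hy => ?_).add continuousOn_const
    have := hpos y hy
    positivity
  have hle : ∫ y in z..1, w y / y ^ 2 ≤ ∫ y in z..1, (ε / y ^ 2 + K) := by
    refine intervalIntegral.integral_mono_on hz1 (hw.intervalIntegrable hz hz1) hint
      fun y hy => ?_
    have hy0 := hpos y hy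
    rw [div_add' _ _ _ (by positivity)]
    gcongr
    exact h y hy0 hy.2
  have heq : ∫ y in z..1, (ε / y ^ 2 + K) = (-ε * 1⁻¹ + K * 1) - (-ε * z⁻¹ + K * z) := by
    refine intervalIntegral.integral_eq_sub_of_hasDerivAt
      (f := fun y : ℝ => -ε * y⁻¹ + K * y) (fun y hy => ?_) hint
    rw [Set.uIcc_of_le hz1] at hy
    have hderiv := ((hasDerivAt_inv (hpos y hy).ne').const_mul (-ε)).add
      ((hasDerivAt_id y).const_mul K)
    exact hderiv.congr_deriv (by ring)
  calc z * ∫ y in z..1, w y / y ^ 2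
      ≤ z * ((-ε * 1⁻¹ + K * 1) - (-ε * z⁻¹ + K * z)) := by
        rw [← heq]
        gcongr
    _ = ε + K * z - z * ε - K * z ^ 2 := by
        field_simp
        ring
    _ ≤ ε + K * z := by
        have : 0 ≤ z * ε := by positivity
        have : 0 ≤ K * z ^ 2 := by positivity
        linarith

open Set Filter Topology in
lemma IsModulus.tendsto_mul_integral {w : ℝ → ℝ} (hw : IsModulus w) :
    Tendsto (fun z : ℝ => z * ∫ y in z..1, w y / y ^ 2) (𝓝[>] 0) (𝓝 0) := by
  have hIoo (a : ℝ) (ha : 0 < a) : Ioo 0 a ∈ 𝓝[>] (0 : ℝ) := Ioo_mem_nhdsGT ha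
  refine tendsto_order.2 ⟨fun a ha => ?_, fun a ha => ?_⟩
  · filter_upwards [hIoo 1 one_pos] with z hz
    refine ha.trans_le (mul_nonneg hz.1.le
      (intervalIntegral.integral_nonneg hz.2.le fun y hy => ?_))
    have := hw.pos y (hz.1.trans_le hy.1)
    positivity
  · obtain ⟨K, hK, h⟩ := hw.exists_le_add_mul_sq (half_pos ha)
    filter_upwards [hIoo 1 one_pos, hIoo (a / 2 / K) (by positivity)] with z hz hzK
    have hle := mul_integral_le_of_le_add_mul_sq hw (half_pos ha).le hK.le h hz.1 hz.2.le
    have := (lt_div_iff₀ hK).1 hzK.2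
    linarith

/-- For a modulus of continuity `ϖ`, `z ∫_z^1 ϖ(y)/y² dy → 0` as `z → 0⁺`; in
particular `λⁿ ∫_{λⁿ}^1 ϖ(y)/y² dy → 0` for every `λ ∈ (0,1)`. -/
theorem tendsto_mul_integral_zero
    (w : ℝ → ℝ) (hw : IsModulus w) :
    Filter.Tendsto (fun z : ℝ => z * ∫ y in z..1, w y / y ^ 2)
      (nhdsWithin 0 (Set.Ioi 0)) (nhds 0) ∧
    ∀ lam : ℝ, 0 < lam → lam < 1 →
      Filter.Tendsto (fun n : ℕ => lam ^ n * ∫ y in (lam ^ n)..1, w y / y ^ 2)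
        Filter.atTop (nhds 0) := by
  refine ⟨hw.tendsto_mul_integral, fun lam h0 h1 => ?_⟩
  exact hw.tendsto_mul_integral.comp (tendsto_pow_atTop_nhdsWithin_zero_of_lt_one h0 h1)
end
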